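/- Suppose a separable metrizable space X has an open subset U such that U is meager in X and U contains a subspace homeomorphic to the Cantor set 2^ω. Then X has continuum many types of countable dense subsets: there exists a family (D_α)_{α < 𝔠} of countable dense subsets of X such that for all α ≠ β there is no homeomorphism h of X onto itself with h(D_α) = D_β. -/

import Mathlib

open Set Topology

/-- A subset `S` of a topological space `X` is meager in `X` if it is a countable union
of sets nowhere dense in `X`. -/
def MeagerIn {X : Type*} [TopologicalSpace X] (S : Set X) : Prop :=
  ∃ f : ℕ → Set X, (∀ n, IsNowhereDense (f n)) ∧ S = ⋃ n, f n

/-! ### The invariant -/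

/-- A Cantor-Bendixson type derivative. -/
def cbDer {X : Type*} [TopologicalSpace X] (T : Set X) : Set X :=
  {x | x ∈ T ∧ x ∈ closure (T \ {x})}

/-- Iterated derivatives of the closure of `A`. -/
def cbSeq {X : Type*} [TopologicalSpace X] (A : Set X) : ℕ → Set X
  | 0 => closure A
  | n + 1 => cbDer (cbSeq A n)

/-- The set of ranks occurring in `A`. -/
def cbRanks {X : Type*} [TopologicalSpace X] (A : Set X) : Set ℕ :=
  {n | ∃ x ∈ A, x ∈ cbSeq A n ∧ x ∉ cbSeq A (n + 1)}

theorem cbDer_image {X Y : Type*} [TopologicalSpace X] [TopologicalSpace Y] {f : X → Y}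
    (hf : IsClosedEmbedding f) (T : Set X) : cbDer (f '' T) = f '' cbDer T := by
  have key : ∀ x, f '' T \ {f x} = f '' (T \ {x}) := by
    intro x
    rw [image_sdiff hf.injective, image_singleton]
  ext y
  constructor
  · rintro ⟨⟨x, hx, rfl⟩, h2⟩
    rw [key, hf.closure_image_eq] at h2
    obtain ⟨z, hz, hzx⟩ := h2
    obtain rfl := hf.injective hzx
    exact ⟨z, ⟨hx, hz⟩, rfl⟩
  · rintro ⟨x, ⟨hx, hx2⟩, rfl⟩
    refine ⟨⟨x, hx, rfl⟩, ?_⟩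
    rw [key, hf.closure_image_eq]
    exact ⟨x, hx2, rfl⟩

theorem cbSeq_image {X Y : Type*} [TopologicalSpace X] [TopologicalSpace Y] {f : X → Y}
    (hf : IsClosedEmbedding f) (A : Set X) (n : ℕ) : cbSeq (f '' A) n = f '' cbSeq A n := by
  induction n with
  | zero => exact hf.closure_image_eq A
  | succ n ih => simp only [cbSeq]; rw [ih, cbDer_image hf]

theorem cbRanks_image {X Y : Type*} [TopologicalSpace X] [TopologicalSpace Y] {f : X → Y}
    (hf : IsClosedEmbedding f) (A : Set X) : cbRanks (f '' A) = cbRanks A := by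
  ext n
  simp only [cbRanks, cbSeq_image hf, mem_ofPred_eq]
  constructor
  · rintro ⟨_, ⟨x, hx, rfl⟩, h1, h2⟩
    exact ⟨x, hx, (hf.injective.mem_set_image).1 h1, fun h => h2 ⟨x, h, rfl⟩⟩
  · rintro ⟨x, hx, h1, h2⟩
    exact ⟨f x, ⟨x, hx, rfl⟩, ⟨x, h1, rfl⟩, fun h => h2 ((hf.injective.mem_set_image).1 h)⟩

theorem isOpen_coord (i : ℕ) : IsOpen {x : ℕ → Bool | x i = true} := by
  have h : Continuous (fun x : ℕ → Bool => x i) := continuous_apply i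
  exact (isOpen_discrete ({true} : Set Bool)).preimage h

/-! ### The explicit sets in the Cantor space -/

/-- Points of the Cantor space with few ones compared with the position of the first one. -/
def eSet (k : ℕ) : Set (ℕ → Bool) :=
  {x | ∀ m, x m = true → ∀ s : Finset ℕ, (∀ i ∈ s, x i = true) → s.card + k ≤ m + 1}

theorem eSet_isClosed (k : ℕ) : IsClosed (eSet k) := by
  have h : eSet k = ⋂ (m : ℕ) (s : Finset ℕ),
      ({x | x m = true} ∩ ⋂ i ∈ s, {x | x i = true})ᶜ ∪ {_x : ℕ → Bool | s.card + k ≤ m + 1} := by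
    ext x
    simp only [eSet, mem_ofPred_eq, mem_iInter, mem_union, mem_compl_iff, mem_inter_iff]
    constructor
    · intro h m s
      by_cases h1 : x m = true ∧ ∀ i ∈ s, x i = true
      · exact Or.inr (h m h1.1 s h1.2)
      · exact Or.inl h1
    · intro h m hm s hs
      rcases h m s with h1 | h1
      · exact absurd ⟨hm, hs⟩ h1
      · exact h1
  rw [h]
  refine isClosed_iInter fun m => isClosed_iInter fun s => IsClosed.union ?_ isClosed_const
  exact ((isOpen_coord m).inter (isOpen_biInter_finset fun i _ => isOpen_coord i)).isClosed_compl

theorem eSet_anti {k l : ℕ} (h : k ≤ l) : eSet l ⊆ eSet k := by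
  intro x hx m hm s hs
  have := hx m hm s hs
  omega

/-- Isolation of points of exact rank. -/
theorem eSet_isolated {k : ℕ} {x : ℕ → Bool} (hx : x ∈ eSet k) (hx' : x ∉ eSet (k + 1)) :
    ∃ s : Finset ℕ, (∀ i ∈ s, x i = true) ∧
      ∀ y ∈ eSet k, (∀ i ∈ s, y i = true) → y = x := by
  simp only [eSet, mem_ofPred_eq, not_forall] at hx'
  obtain ⟨m, hm, s, hs, hc⟩ := hx'
  have key : ∀ y ∈ eSet k, y m = true → (∀ i ∈ s, y i = true) → ∀ i, y i = true → i ∈ s := by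
    intro y hy hym hys i hi
    by_contra his
    have := hy m hym (insert i s) (by
      intro j hj
      rcases Finset.mem_insert.1 hj with rfl | hj
      · exact hi
      · exact hys j hj)
    rw [Finset.card_insert_of_notMem his] at this
    omega
  have hms : m ∈ s := key x hx hm hs m hm
  refine ⟨s, hs, fun y hy hys => ?_⟩
  funext i
  by_cases hi : i ∈ s
  · rw [hys i hi, hs i hi]
  · have h1 : ¬ y i = true := fun h => hi (key y hy (hys m hms) hys i h)
    have h2 : ¬ x i = true := fun h => hi (key x hx hm hs i h)
    rw [Bool.not_eq_true] at h1 h2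
    rw [h1, h2]

/-- A convenient criterion for membership in a closure in the Cantor space. -/
theorem mem_closure_cantor {x : ℕ → Bool} {S : Set (ℕ → Bool)}
    (h : ∀ N, ∃ y ∈ S, ∀ i < N, y i = x i) : x ∈ closure S := by
  choose y hy hyx using h
  refine mem_closure_of_tendsto (f := y) (b := Filter.atTop) ?_ (Filter.Eventually.of_forall hy)
  rw [tendsto_pi_nhds]
  intro i
  refine tendsto_const_nhds.congr' ?_
  filter_upwards [Filter.eventually_gt_atTop i] with N hN
  exact (hyx N i hN).symm

theorem eSet_finite {k : ℕ} {x : ℕ → Bool} (hx : x ∈ eSet k) : ∃ M, ∀ i, x i = true → i < M := by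
  by_cases h : ∃ m, x m = true
  · obtain ⟨m, hm⟩ := h
    have hfin : {i | x i = true}.Finite := by
      by_contra hinf
      obtain ⟨s, hs, hc⟩ := Set.Infinite.exists_subset_card_eq hinf (m + 2)
      have := hx m hm s (fun i hi => hs hi)
      omega
    obtain ⟨M, hM⟩ := hfin.bddAbove
    exact ⟨M + 1, fun i hi => Nat.lt_succ_of_le (hM hi)⟩
  · push Not at h
    exact ⟨0, fun i hi => absurd hi (h i)⟩

theorem eSet_extend {k : ℕ} {x : ℕ → Bool} (hx : x ∈ eSet (k + 1)) (N : ℕ) :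
    ∃ j, N ≤ j ∧ x j = false ∧ Function.update x j true ∈ eSet k := by
  classical
  obtain ⟨M, hM⟩ := eSet_finite hx
  have hb : ∀ s : Finset ℕ, (∀ i ∈ s, x i = true) → s.card ≤ M := by
    intro s hs
    have : s ⊆ Finset.range M := fun i hi => Finset.mem_range.2 (hM i (hs i hi))
    simpa using Finset.card_le_card this
  refine ⟨N + M + k, by omega, ?_, ?_⟩
  · by_contra h
    have := hM (N + M + k) (by simpa using h)
    omega
  · intro m hm s hs
    have hs' : ∀ i ∈ s.erase (N + M + k), x i = true := by
      intro i hi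
      have := hs i (Finset.mem_of_mem_erase hi)
      rwa [Function.update_of_ne (Finset.ne_of_mem_erase hi)] at this
    have hcard : s.card ≤ (s.erase (N + M + k)).card + 1 := by
      have := Finset.pred_card_le_card_erase (s := s) (a := N + M + k)
      omega
    by_cases hmj : m = N + M + k
    · have := hb _ hs'
      omega
    · rw [Function.update_of_ne hmj] at hm
      have := hx m hm _ hs'
      omega

theorem cbDer_eSet (k : ℕ) : cbDer (eSet k) = eSet (k + 1) := by
  ext x
  constructor
  · rintro ⟨hx, hcl⟩
    by_contra hx'
    obtain ⟨s, hs, hiso⟩ := eSet_isolated hx hx'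
    have ho : IsOpen (⋂ i ∈ s, {x : ℕ → Bool | x i = true}) :=
      isOpen_biInter_finset fun i _ => isOpen_coord i
    obtain ⟨y, hy1, hy2, hy3⟩ := mem_closure_iff.1 hcl _ ho (by simpa using hs)
    exact hy3 (hiso y hy2 (by simpa using hy1))
  · intro hx
    refine ⟨eSet_anti (Nat.le_succ k) hx, mem_closure_cantor fun N => ?_⟩
    obtain ⟨j, hj, hxj, hmem⟩ := eSet_extend hx N
    refine ⟨_, ⟨hmem, ?_⟩, fun i hi => Function.update_of_ne (by omega) _ _⟩
    intro h
    have h2 := congrFun (mem_singleton_iff.1 h) j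
    rw [Function.update_self, hxj] at h2
    exact absurd h2 (by simp)

theorem eSet_mem_closure_aux (d : ℕ) : eSet d \ eSet (d + 1) ⊆ closure (eSet 0 \ eSet 1) := by
  classical
  induction d with
  | zero => exact subset_closure
  | succ d ih =>
    rintro x ⟨hx, hx'⟩
    rw [← closure_closure]
    refine closure_mono ih (mem_closure_cantor fun N => ?_)
    obtain ⟨j, hj, hxj, hmem⟩ := eSet_extend hx N
    refine ⟨_, ⟨hmem, fun h => hx' ?_⟩, fun i hi => Function.update_of_ne (by omega) _ _⟩
    intro m hm s hs
    have hne : ∀ i, x i = true → i ≠ j := by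
      rintro i hi rfl
      rw [hxj] at hi
      exact absurd hi (by simp)
    have := h m (by rwa [Function.update_of_ne (hne m hm)]) (insert j s) (by
      intro i hi
      rcases Finset.mem_insert.1 hi with rfl | hi
      · simp
      · rw [Function.update_of_ne (hne i (hs i hi))]; exact hs i hi)
    rw [Finset.card_insert_of_notMem (fun hjs => hne j (hs j hjs) rfl)] at this
    omega

theorem single_mem (k : ℕ) : (fun i => decide (i = k)) ∈ eSet k \ eSet (k + 1) := by
  constructor
  · intro m hm s hs
    have hm : m = k := by simpa using hm
    have : s ⊆ {k} := fun i hi => by simpa using hs i hi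
    have := Finset.card_le_card this
    simp at this
    omega
  · intro h
    have := h k (by simp) {k} (by simp)
    simp at this

theorem eSet_zero_subset : eSet 0 ⊆ closure (eSet 0 \ eSet 1) := by
  intro x hx
  by_cases h : ∃ m, x m = true
  · obtain ⟨m, hm⟩ := h
    have hex : ∃ d, x ∉ eSet d := ⟨m + 1, fun h => by
      have := h m hm {m} (by simpa using hm)
      simp at this⟩
    classical
    have h0 : Nat.find hex ≠ 0 := fun h0 => by
      have := Nat.find_spec hex
      rw [h0] at this
      exact this hx
    obtain ⟨d, hd⟩ := Nat.exists_eq_succ_of_ne_zero h0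
    have h1 := Nat.find_spec hex
    have h2 := Nat.find_min hex (m := d) (by omega)
    rw [hd] at h1
    exact eSet_mem_closure_aux d ⟨not_not.1 h2, h1⟩
  · push Not at h
    rw [← closure_closure]
    refine mem_closure_cantor fun N => ⟨_, eSet_mem_closure_aux N (single_mem N), fun i hi => ?_⟩
    have := h i
    rw [ne_eq, Bool.not_eq_true] at this
    rw [this]
    simp
    omega

/-- The coding set. -/
def codeSet (S : Set ℕ) : Set (ℕ → Bool) :=
  {x | ∃ k, (k = 0 ∨ k ∈ S) ∧ x ∈ eSet k ∧ x ∉ eSet (k + 1)}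

theorem cbSeq_codeSet (S : Set ℕ) (n : ℕ) : cbSeq (codeSet S) n = eSet n := by
  induction n with
  | zero =>
    refine subset_antisymm (closure_minimal ?_ (eSet_isClosed 0)) ?_
    · rintro x ⟨k, -, hk, -⟩
      exact eSet_anti (Nat.zero_le k) hk
    · refine eSet_zero_subset.trans (closure_mono ?_)
      rintro x ⟨h1, h2⟩
      exact ⟨0, Or.inl rfl, h1, h2⟩
  | succ n ih => rw [cbSeq, ih, cbDer_eSet]

theorem cbRanks_codeSet (S : Set ℕ) : cbRanks (codeSet S) = {k | k = 0 ∨ k ∈ S} := by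
  ext n
  simp only [cbRanks, cbSeq_codeSet, mem_ofPred_eq]
  constructor
  · rintro ⟨x, ⟨k, hk, h1, h2⟩, h3, h4⟩
    have : k = n := by
      rcases lt_trichotomy k n with h | h | h
      · exact absurd (eSet_anti h h3) h2
      · exact h
      · exact absurd (eSet_anti h h1) h4
    rwa [← this]
  · intro hn
    exact ⟨_, ⟨n, hn, single_mem n⟩, single_mem n⟩

theorem codeSet_countable (S : Set ℕ) : (codeSet S).Countable := by
  refine (countable_range (fun s : Finset ℕ => fun i => decide (i ∈ s))).mono ?_
  rintro x ⟨k, -, hx, -⟩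
  obtain ⟨M, hM⟩ := eSet_finite hx
  refine ⟨(Finset.range M).filter (fun i => x i = true), ?_⟩
  funext i
  have := hM i
  by_cases h : x i = true
  · simp [h, this h]
  · simp [h]

/-! ### Topological part -/

/-- `W` contains a copy of the Cantor set. -/
def HasCantor {X : Type*} [TopologicalSpace X] (W : Set X) : Prop :=
  ∃ g : (ℕ → Bool) → X, Continuous g ∧ Function.Injective g ∧ range g ⊆ W

/-- Points which are locally meager, and near which there are Cantor sets. -/
def zSet (X : Type*) [TopologicalSpace X] : Set X :=
  {x | (∃ O, IsOpen O ∧ x ∈ O ∧ IsMeagre O) ∧ ∀ O, IsOpen O → x ∈ O → HasCantor O}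

theorem zSet_map {X : Type*} [TopologicalSpace X] (h : X ≃ₜ X) {x : X} (hx : x ∈ zSet X) :
    h x ∈ zSet X := by
  obtain ⟨⟨O, hO, hxO, hm⟩, hc⟩ := hx
  refine ⟨⟨h '' O, h.isOpenMap _ hO, ⟨x, hxO, rfl⟩, h.isInducing.isMeagre_image hm⟩, ?_⟩
  intro W hW hxW
  obtain ⟨g, hg1, hg2, hg3⟩ := hc (h ⁻¹' W) (hW.preimage h.continuous) hxW
  refine ⟨h ∘ g, h.continuous.comp hg1, h.injective.comp hg2, ?_⟩
  rintro _ ⟨z, rfl⟩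
  exact hg3 ⟨z, rfl⟩

theorem zSet_image {X : Type*} [TopologicalSpace X] (h : X ≃ₜ X) : h '' zSet X = zSet X := by
  refine subset_antisymm ?_ ?_
  · rintro _ ⟨x, hx, rfl⟩
    exact zSet_map h hx
  · intro x hx
    exact ⟨h.symm x, zSet_map h.symm hx, by simp⟩

theorem hasCantor_nhds {X : Type*} [TopologicalSpace X] {g : (ℕ → Bool) → X}
    (hg : Continuous g) (hinj : Function.Injective g) (x : ℕ → Bool) {W : Set X}
    (hW : IsOpen W) (hx : g x ∈ W) : HasCantor W := by
  have hcont : ∀ N : ℕ, Continuous (fun (y : ℕ → Bool) (i : ℕ) => if i < N then x i else y (i - N)) := by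
    intro N
    refine continuous_pi fun i => ?_
    by_cases hi : i < N
    · simp only [hi, if_true]; exact continuous_const
    · simp only [hi, if_false]; exact continuous_apply _
  have hex : ∃ N : ℕ, ∀ y : ℕ → Bool, (∀ i < N, y i = x i) → y ∈ g ⁻¹' W := by
    by_contra hcon
    push Not at hcon
    have : x ∈ closure (g ⁻¹' W)ᶜ := mem_closure_cantor fun N => by
      obtain ⟨y, h1, h2⟩ := hcon N
      exact ⟨y, h2, h1⟩
    rw [(hW.preimage hg).isClosed_compl.closure_eq] at this
    exact this hx
  obtain ⟨N, hN⟩ := hex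
  refine ⟨_, hg.comp (hcont N), ?_, ?_⟩
  · intro y z hyz
    have h := hinj hyz
    funext i
    have := congrFun h (i + N)
    simpa using this
  · rintro _ ⟨y, rfl⟩
    exact hN _ (fun i hi => by simp [hi])

/-- No countable dense set in the Cantor space is a `Gδ`. -/
theorem cantor_not_gdelta {Q : Set (ℕ → Bool)} (hc : Q.Countable) (hd : Dense Q) : ¬ IsGδ Q := by
  intro hG
  have hne : ∀ x : ℕ → Bool, Dense ({x}ᶜ : Set (ℕ → Bool)) := by
    intro x z
    refine mem_closure_cantor fun N => ?_
    by_cases h : z = x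
    · refine ⟨Function.update z N (!z N), ?_, fun i hi => Function.update_of_ne (by omega) _ _⟩
      intro h2
      have h3 := congrFun (mem_singleton_iff.1 h2) N
      rw [Function.update_self, h] at h3
      cases hx : x N <;> simp [hx] at h3
    · exact ⟨z, h, fun _ _ => rfl⟩
  have hd2 : Dense (Qᶜ) := by
    have : Qᶜ = ⋂ x ∈ Q, ({x}ᶜ : Set (ℕ → Bool)) := by
      ext y
      simp only [mem_compl_iff, mem_iInter, mem_singleton_iff]
      exact ⟨fun h x hx hyx => h (hyx ▸ hx), fun h hy => h y hy rfl⟩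
    rw [this]
    exact dense_biInter_of_isOpen (fun x _ => isOpen_compl_singleton) hc (fun x _ => hne x)
  have := Dense.inter_of_Gδ hG hc.isGδ_compl hd hd2
  rw [inter_compl_self] at this
  obtain ⟨x, hx⟩ := this.nonempty
  exact hx

/-- Splitting around a closed set: an open set having the Cantor set in its boundary. -/
theorem exists_split {X : Type*} [MetricSpace X] {f : (ℕ → Bool) → X} (hf : Continuous f)
    {V : Set X} (hV : IsOpen V)
    (hK : ∀ q, ∀ r > 0, ∃ y ∈ V, y ∉ range f ∧ dist y (f q) < r) :
    ∃ O, IsOpen O ∧ O ⊆ V ∧ ∀ q, f q ∈ closure O ∧ f q ∈ closure (closure O)ᶜ := by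
  have hcl : IsClosed (range f) := (isCompact_range hf).isClosed
  have hne : (range f).Nonempty := range_nonempty f
  obtain ⟨q, hq⟩ := TopologicalSpace.exists_dense_seq (ℕ → Bool)
  let p : ℕ → X := fun n => f (q (Nat.unpair (n / 2)).1)
  have step : ∀ (n : ℕ) (r : {r : ℝ // 0 < r}), ∃ y : X, y ∈ V ∧ y ∉ range f ∧
      dist y (p n) < 1 / ((n : ℝ) + 1) ∧ Metric.infDist y (range f) < r := by
    intro n r
    have h1 : (0 : ℝ) < 1 / ((n : ℝ) + 1) := by positivity
    obtain ⟨y, hy1, hy2, hy3⟩ := hK (q (Nat.unpair (n / 2)).1) (min (1 / ((n : ℝ) + 1)) r)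
      (lt_min h1 r.2)
    exact ⟨y, hy1, hy2, hy3.trans_le (min_le_left _ _),
      (Metric.infDist_le_dist_of_mem (mem_range_self _)).trans_lt (hy3.trans_le (min_le_right _ _))⟩
  choose g hgV hgK hgp hgr using step
  have hpos : ∀ y, y ∉ range f → 0 < Metric.infDist y (range f) := fun y hy =>
    (hcl.notMem_iff_infDist_pos hne).1 hy
  let R : ℕ → {r : ℝ // 0 < r} := fun n => Nat.rec ⟨1, one_pos⟩
    (fun n r => ⟨Metric.infDist (g n r) (range f), hpos _ (hgK n r)⟩) n
  let y : ℕ → X := fun n => g n (R n)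
  have hRs : ∀ n, (R (n + 1) : ℝ) = Metric.infDist (y n) (range f) := fun n => rfl
  have hanti : StrictAnti (fun n => Metric.infDist (y n) (range f)) := by
    refine strictAnti_nat_of_succ_lt fun n => ?_
    have := hgr (n + 1) (R (n + 1))
    rwa [hRs] at this
  have hinj : Function.Injective y := by
    intro a b hab
    exact hanti.injective (by simp only [hab])
  have hsmall : ∀ n, Metric.infDist (y n) (range f) < 1 / ((n : ℝ) + 1) := fun n =>
    (Metric.infDist_le_dist_of_mem (mem_range_self _)).trans_lt (hgp n (R n))
  have hsep : ∀ (I : Set ℕ) (n : ℕ), n ∉ I → y n ∉ closure (y '' I) := by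
    intro I n hn hcln
    have hδ := hpos _ (hgK n (R n))
    obtain ⟨M, hM⟩ := exists_nat_one_div_lt (half_pos hδ)
    have hsub : y '' I ⊆ y '' (I ∩ Iio M) ∪
        {x | Metric.infDist x (range f) ≤ Metric.infDist (y n) (range f) / 2} := by
      rintro _ ⟨i, hi, rfl⟩
      by_cases hiM : i < M
      · exact Or.inl ⟨i, ⟨hi, hiM⟩, rfl⟩
      · right
        have hle : (1 : ℝ) / ((i : ℝ) + 1) ≤ 1 / ((M : ℝ) + 1) := by
          have : (M : ℝ) ≤ i := by exact_mod_cast not_lt.1 hiM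
          gcongr
        exact ((hsmall i).trans_le hle).le.trans hM.le
    have hclosed : IsClosed (y '' (I ∩ Iio M) ∪
        {x | Metric.infDist x (range f) ≤ Metric.infDist (y n) (range f) / 2}) := by
      refine IsClosed.union ?_ (isClosed_le (Metric.continuous_infDist_pt _) continuous_const)
      exact (((finite_Iio M).subset inter_subset_right).image y).isClosed
    rcases closure_minimal hsub hclosed hcln with ⟨i, ⟨hi, -⟩, hiy⟩ | h
    · exact hn (hinj hiy ▸ hi)
    · have h' : Metric.infDist (y n) (range f) ≤ Metric.infDist (y n) (range f) / 2 := h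
      have hδ' : 0 < Metric.infDist (y n) (range f) := hδ
      linarith
  let I1 : Set ℕ := range (fun j => 2 * j)
  let I2 : Set ℕ := range (fun j => 2 * j + 1)
  have hacc : ∀ (c : ℕ), c < 2 → ∀ a, f a ∈ closure (y '' range (fun j => 2 * j + c)) := by
    intro c hc a
    have ha : f a ∈ closure (range (f ∘ q)) := by
      rw [range_comp]
      exact image_closure_subset_closure_image hf ⟨a, hq a, rfl⟩
    rw [Metric.mem_closure_iff] at ha ⊢
    intro ε hε
    obtain ⟨_, ⟨i, rfl⟩, hi⟩ := ha (ε / 2) (half_pos hε)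
    obtain ⟨m, hm⟩ := exists_nat_one_div_lt (half_pos hε)
    refine ⟨y (2 * Nat.pair i m + c), ⟨_, ⟨_, rfl⟩, rfl⟩, ?_⟩
    have h1 := hgp (2 * Nat.pair i m + c) (R (2 * Nat.pair i m + c))
    have h2 : p (2 * Nat.pair i m + c) = f (q i) := by
      have : (2 * Nat.pair i m + c) / 2 = Nat.pair i m := by omega
      simp only [p, this, Nat.unpair_pair]
    rw [h2] at h1
    have h3 : (1 : ℝ) / (((2 * Nat.pair i m + c : ℕ) : ℝ) + 1) ≤ 1 / ((m : ℝ) + 1) := by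
      have : (m : ℝ) ≤ ((2 * Nat.pair i m + c : ℕ) : ℝ) := by
        have := Nat.right_le_pair i m
        exact_mod_cast (by omega : m ≤ 2 * Nat.pair i m + c)
      gcongr
    have h4 : dist (f (q i)) (y (2 * Nat.pair i m + c)) < ε / 2 := by
      rw [dist_comm]
      exact (h1.trans_le h3).trans hm
    have hi' : dist (f a) (f (q i)) < ε / 2 := hi
    have := dist_triangle (f a) (f (q i)) (y (2 * Nat.pair i m + c))
    linarith
  have hne1 : (y '' I1).Nonempty := ⟨_, _, ⟨0, rfl⟩, rfl⟩
  have hne2 : (y '' I2).Nonempty := ⟨_, _, ⟨0, rfl⟩, rfl⟩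
  have hy1 : ∀ n ∈ I1, 0 < Metric.infDist (y n) (y '' I2) := by
    rintro _ ⟨j, rfl⟩
    rw [← Metric.infDist_closure, ← isClosed_closure.notMem_iff_infDist_pos hne2.closure]
    refine hsep _ _ ?_
    rintro ⟨i, hi⟩
    simp only at hi
    omega
  have hy2 : ∀ n ∈ I2, 0 < Metric.infDist (y n) (y '' I1) := by
    rintro _ ⟨j, rfl⟩
    rw [← Metric.infDist_closure, ← isClosed_closure.notMem_iff_infDist_pos hne1.closure]
    refine hsep _ _ ?_
    rintro ⟨i, hi⟩
    simp only at hi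
    omega
  have c1 := Metric.continuous_infDist_pt (y '' I1)
  have c2 := Metric.continuous_infDist_pt (y '' I2)
  refine ⟨V ∩ {x | Metric.infDist x (y '' I1) < Metric.infDist x (y '' I2)},
    hV.inter (isOpen_lt c1 c2), inter_subset_left, fun a => ⟨?_, ?_⟩⟩
  · refine closure_mono ?_ (hacc 0 (by omega) a)
    rintro _ ⟨n, hn, rfl⟩
    refine ⟨hgV _ _, ?_⟩
    have h0 : Metric.infDist (y n) (y '' I1) = 0 := Metric.infDist_zero_of_mem ⟨n, hn, rfl⟩
    simp only [mem_ofPred_eq, h0]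
    exact hy1 n hn
  · refine closure_mono ?_ (hacc 1 (by omega) a)
    rintro _ ⟨n, hn, rfl⟩ hcon
    have h0 : Metric.infDist (y n) (y '' I2) = 0 := Metric.infDist_zero_of_mem ⟨n, hn, rfl⟩
    have hsub : V ∩ {x | Metric.infDist x (y '' I1) < Metric.infDist x (y '' I2)} ⊆
        {x | Metric.infDist x (y '' I1) ≤ Metric.infDist x (y '' I2)} := by
      rintro x ⟨-, hx⟩
      simp only [mem_ofPred_eq] at hx ⊢
      exact hx.le
    have := closure_minimal hsub (isClosed_le c1 c2) hcon
    simp only [mem_ofPred_eq, h0] at this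
    have h2 := hy2 n hn
    linarith

/-- Points of `V` at which `D` is not locally `Gδ`. -/
def nSet {X : Type*} [TopologicalSpace X] (V D : Set X) : Set X :=
  {x | x ∈ V ∧ ∀ W, IsOpen W → x ∈ W → ¬ IsGδ (D ∩ W)}

theorem isGdelta_image {X : Type*} [TopologicalSpace X] (h : X ≃ₜ X) {s : Set X} (hs : IsGδ s) :
    IsGδ (h '' s) := by
  rw [h.image_eq_preimage_symm]
  exact hs.preimage h.symm.continuous

theorem nSet_map {X : Type*} [TopologicalSpace X] (h : X ≃ₜ X) {V D : Set X} (hV : h '' V = V)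
    {x : X} (hx : x ∈ nSet V D) : h x ∈ nSet V (h '' D) := by
  refine ⟨hV ▸ ⟨x, hx.1, rfl⟩, fun W hW hxW hG => ?_⟩
  refine hx.2 (h ⁻¹' W) (hW.preimage h.continuous) hxW ?_
  have := isGdelta_image h.symm hG
  rw [image_inter h.symm.injective] at this
  convert this using 2
  · rw [← image_comp]; simp
  · rw [h.symm.image_eq_preimage_symm]; rfl

theorem image_symm_eq {X : Type*} [TopologicalSpace X] (h : X ≃ₜ X) {V W : Set X}
    (hV : h '' V = W) : h.symm '' W = V := by
  rw [← hV, ← image_comp]; simp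

theorem nSet_image {X : Type*} [TopologicalSpace X] (h : X ≃ₜ X) {V D : Set X} (hV : h '' V = V) :
    h '' nSet V D = nSet V (h '' D) := by
  refine subset_antisymm ?_ ?_
  · rintro _ ⟨x, hx, rfl⟩
    exact nSet_map h hV hx
  · intro x hx
    have := nSet_map h.symm (image_symm_eq h hV) hx
    rw [image_symm_eq h rfl] at this
    exact ⟨h.symm x, this, by simp⟩

/-- Avoiding finitely many closed sets with empty interior. -/
theorem avoid_finite {X : Type*} [TopologicalSpace X] {F : ℕ → Set X} (hc : ∀ n, IsClosed (F n))
    (hi : ∀ n, interior (F n) = ∅) {W : Set X} (hW : IsOpen W) (hne : W.Nonempty) (n : ℕ) :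
    ∃ x ∈ W, ∀ i < n, x ∉ F i := by
  suffices h : ∃ W' ⊆ W, IsOpen W' ∧ W'.Nonempty ∧ ∀ x ∈ W', ∀ i < n, x ∉ F i by
    obtain ⟨W', h1, -, ⟨x, hx⟩, h2⟩ := h
    exact ⟨x, h1 hx, h2 x hx⟩
  induction n with
  | zero => exact ⟨W, subset_rfl, hW, hne, by simp⟩
  | succ n ih =>
    obtain ⟨W', h1, h2, h3, h4⟩ := ih
    refine ⟨W' ∩ (F n)ᶜ, inter_subset_left.trans h1, h2.inter (hc n).isOpen_compl, ?_, ?_⟩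
    · have := (interior_eq_empty_iff_dense_compl.1 (hi n)).inter_open_nonempty W' h2 h3
      exact this
    · rintro x ⟨hx1, hx2⟩ i hin
      rcases Nat.lt_succ_iff_lt_or_eq.1 hin with h | rfl
      · exact h4 x hx1 i h
      · exact hx2

theorem cantor_interior {X : Type*} [TopologicalSpace X] [T2Space X] {f : (ℕ → Bool) → X}
    (hf : IsClosedEmbedding f) {F : ℕ → Set X} (hc : ∀ n, IsClosed (F n))
    (hi : ∀ n, interior (F n) = ∅) {W : Set X} (hW : IsOpen W) (hne : W.Nonempty)
    (hWF : W ⊆ ⋃ n, F n) : ∃ y ∈ W, y ∉ range f := by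
  by_contra hcon
  push Not at hcon
  have hd := dense_iUnion_interior_of_closed (f := fun n => f ⁻¹' (F n) ∪ (f ⁻¹' W)ᶜ)
    (fun n => ((hc n).preimage hf.continuous).union (hW.preimage hf.continuous).isClosed_compl)
    (by
      refine eq_univ_of_forall fun x => mem_iUnion.2 ?_
      by_cases hx : f x ∈ W
      · obtain ⟨n, hn⟩ := mem_iUnion.1 (hWF hx)
        exact ⟨n, Or.inl hn⟩
      · exact ⟨0, Or.inr hx⟩)
  obtain ⟨w, hw⟩ := hne
  obtain ⟨a, rfl⟩ := hcon w hw
  obtain ⟨b, hbW, hb⟩ := hd.inter_open_nonempty _ (hW.preimage hf.continuous) ⟨a, hw⟩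
  obtain ⟨n, hn⟩ := mem_iUnion.1 hb
  obtain ⟨G, hG, hGe⟩ := hf.isInducing.isOpen_iff.1
    (isOpen_interior (s := f ⁻¹' (F n) ∪ (f ⁻¹' W)ᶜ))
  have hsub : G ∩ W ⊆ F n := by
    rintro z ⟨hzG, hzW⟩
    obtain ⟨c, rfl⟩ := hcon z hzW
    have hcG : c ∈ f ⁻¹' G := hzG
    rw [hGe] at hcG
    rcases interior_subset hcG with h | h
    · exact h
    · exact absurd hzW h
  have hbG : b ∈ f ⁻¹' G := by rw [hGe]; exact hn
  have := interior_maximal hsub (hG.inter hW) ⟨hbG, hbW⟩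
  rw [hi n] at this
  exact this

/-- The second case. -/
theorem case_two {X : Type*} [MetricSpace X] [SecondCountableTopology X]
    (hne : (interior (zSet X)).Nonempty) :
    ∃ f : (ℕ → Bool) → X, Continuous f ∧ Function.Injective f ∧
    ∃ D : Set (ℕ → Bool) → Set X, (∀ A, A.Countable → (D A).Countable ∧ Dense (D A)) ∧
      ∀ A B, A.Countable → B.Countable → ∀ h : X ≃ₜ X, h '' D A = D B →
        h '' (f '' A) = f '' B := by
  set V := interior (zSet X) with hVdef
  have hV : IsOpen V := isOpen_interior
  have hVz : ∀ x ∈ V, x ∈ zSet X := fun x hx => interior_subset hx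
  have hVh : ∀ h : X ≃ₜ X, h '' V = V := fun h => by
    rw [hVdef, h.image_interior, zSet_image]
  have hcan : ∀ W, IsOpen W → (W ∩ V).Nonempty → HasCantor (W ∩ V) := by
    rintro W hW ⟨x, hx⟩
    exact (hVz x hx.2).2 _ (hW.inter hV) hx
  obtain ⟨B, hBc, hB0, hB⟩ := TopologicalSpace.exists_countable_basis X
  -- `V` is meager
  have hVm : IsMeagre V := by
    have h1 : IsMeagre (⋃ b ∈ {b ∈ B | IsMeagre b}, b) :=
      isMeagre_biUnion (hBc.mono (sep_subset _ _)) (fun b hb => hb.2)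
    refine h1.mono fun x hx => ?_
    obtain ⟨O, hO, hxO, hOm⟩ := (hVz x hx).1
    obtain ⟨b, hb, hxb, hbO⟩ := hB.exists_subset_of_mem_open hxO hO
    exact mem_biUnion (show b ∈ {b ∈ B | IsMeagre b} from ⟨hb, hOm.mono hbO⟩) hxb
  obtain ⟨S, hSn, hSc, hVS⟩ := isMeagre_iff_countable_union_isNowhereDense.1 hVm
  have hSne : S.Nonempty := by
    obtain ⟨x, hx⟩ := hne
    obtain ⟨s, hs, -⟩ := hVS hx
    exact ⟨s, hs⟩
  obtain ⟨s, rfl⟩ := hSc.exists_eq_range hSne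
  have hsn : ∀ n, interior (closure (s n)) = ∅ := fun n => hSn _ ⟨n, rfl⟩
  have hVF0 : V ⊆ ⋃ n, closure (s n) := by
    intro x hx
    obtain ⟨_, ⟨n, rfl⟩, hn⟩ := hVS hx
    exact mem_iUnion.2 ⟨n, subset_closure hn⟩
  -- a Cantor set
  obtain ⟨f, hfc, hfi, hfV⟩ := hcan univ isOpen_univ (by simpa using hne)
  have hfV : ∀ q, f q ∈ V := fun q => (hfV ⟨q, rfl⟩).2
  have hfe : IsClosedEmbedding f := hfc.isClosedEmbedding hfi
  obtain ⟨O, hO, hOV, hOf⟩ := exists_split hfc hV (by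
    intro q r hr
    obtain ⟨y, hy1, hy2⟩ := cantor_interior hfe (fun n => isClosed_closure) hsn
      (hV.inter Metric.isOpen_ball) ⟨f q, hfV q, Metric.mem_ball_self hr⟩
      (inter_subset_left.trans hVF0)
    exact ⟨y, hy1.1, hy2, hy1.2⟩)
  -- the closed nowhere dense sets
  let F : ℕ → Set X := fun n => Nat.casesOn n (frontier (closure O)) (fun n => closure (s n))
  have hFc : ∀ n, IsClosed (F n) := by
    rintro (_ | n)
    · exact isClosed_frontier
    · exact isClosed_closure
  have hFi : ∀ n, interior (F n) = ∅ := by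
    rintro (_ | n)
    · exact interior_frontier isClosed_closure
    · exact hsn n
  have hVF : ∀ x ∈ V, ∃ n, x ∈ F n := by
    intro x hx
    obtain ⟨n, hn⟩ := mem_iUnion.1 (hVF0 hx)
    exact ⟨n + 1, hn⟩
  have hBne : B.Nonempty := by
    obtain ⟨x, hx⟩ := hne
    obtain ⟨b, hb, -⟩ := hB.exists_subset_of_mem_open hx hV
    exact ⟨b, hb⟩
  obtain ⟨b, rfl⟩ := hBc.exists_eq_range hBne
  have hbo : ∀ n, IsOpen (b n) := fun n => hB.isOpen ⟨n, rfl⟩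
  have hbne : ∀ n, (b n).Nonempty := fun n =>
    nonempty_iff_ne_empty.2 fun h => hB0 ⟨n, h⟩
  have hd : ∀ n, ∃ x ∈ b n, x ∈ V → ∀ i < n + 1, x ∉ F i := by
    intro n
    by_cases h : (b n ∩ V).Nonempty
    · obtain ⟨x, hx, hx2⟩ := avoid_finite hFc hFi ((hbo n).inter hV) h (n + 1)
      exact ⟨x, hx.1, fun _ => hx2⟩
    · obtain ⟨x, hx⟩ := hbne n
      exact ⟨x, hx, fun hxV => absurd ⟨x, hx, hxV⟩ h⟩
  choose d hdb hdF using hd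
  have hQ : ∀ n, ∃ Q : Set X, Q.Countable ∧ Q ⊆ O ∧ ((b n ∩ O).Nonempty →
      ∃ g : (ℕ → Bool) → X, Continuous g ∧ Function.Injective g ∧ range g ⊆ b n ∧
        Dense (g ⁻¹' Q)) := by
    intro n
    by_cases h : (b n ∩ O).Nonempty
    · obtain ⟨g, hg1, hg2, hg3⟩ := hcan (b n ∩ O) ((hbo n).inter hO)
        (h.mono fun x hx => ⟨hx, hOV hx.2⟩)
      obtain ⟨Q, hQc, hQd⟩ := TopologicalSpace.exists_countable_dense (ℕ → Bool)
      refine ⟨g '' Q, hQc.image g, ?_, fun _ => ⟨g, hg1, hg2, fun x hx => (hg3 hx).1.1, ?_⟩⟩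
      · rintro _ ⟨x, -, rfl⟩
        exact (hg3 ⟨x, rfl⟩).1.2
      · exact hQd.mono (subset_preimage_image g Q)
    · exact ⟨∅, countable_empty, empty_subset _, fun h' => absurd h' h⟩
  choose Q hQc hQO hQg using hQ
  let D : Set (ℕ → Bool) → Set X := fun A => range d ∪ (⋃ n, Q n) ∪ f '' A
  have hDc : ∀ A, A.Countable → (D A).Countable := fun A hA =>
    ((countable_range d).union (countable_iUnion hQc)).union (hA.image f)
  have hDd : ∀ A, Dense (D A) := by
    intro A
    rw [hB.dense_iff]
    rintro _ ⟨n, rfl⟩ -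
    exact ⟨d n, hdb n, Or.inl (Or.inl ⟨n, rfl⟩)⟩
  have hfcl : ∀ q, f q ∈ frontier (closure O) := by
    intro q
    rw [frontier_eq_closure_inter_closure, closure_closure]
    exact hOf q
  -- the set of non-`Gδ` points
  have hN : ∀ A, A.Countable → nSet V (D A) = V ∩ closure O := by
    intro A hA
    ext x
    constructor
    · rintro ⟨hxV, hx⟩
      refine ⟨hxV, ?_⟩
      by_contra hxO
      refine hx (V ∩ (closure O)ᶜ) (hV.inter isClosed_closure.isOpen_compl) ⟨hxV, hxO⟩ ?_
      have heq : D A ∩ (V ∩ (closure O)ᶜ) =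
          (V ∩ (closure O)ᶜ) ∩ ⋂ n, ((F n)ᶜ ∪ d '' Iio n) := by
        ext z
        constructor
        · rintro ⟨hzD, hzV, hzO⟩
          refine ⟨⟨hzV, hzO⟩, mem_iInter.2 fun n => ?_⟩
          rcases hzD with (⟨m, rfl⟩ | hz) | ⟨q, -, rfl⟩
          · by_cases hmn : m < n
            · exact Or.inr ⟨m, hmn, rfl⟩
            · exact Or.inl (hdF m hzV n (by omega))
          · obtain ⟨m, hm⟩ := mem_iUnion.1 hz
            exact absurd (subset_closure (hQO m hm)) hzO
          · exact absurd (hOf q).1 hzO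
        · rintro ⟨⟨hzV, hzO⟩, hz⟩
          refine ⟨?_, hzV, hzO⟩
          obtain ⟨n, hn⟩ := hVF z hzV
          rcases mem_iInter.1 hz n with h | ⟨m, -, rfl⟩
          · exact absurd hn h
          · exact Or.inl (Or.inl ⟨m, rfl⟩)
      rw [heq]
      refine IsGδ.inter (hV.inter isClosed_closure.isOpen_compl).isGδ (IsGδ.iInter fun n => ?_)
      exact (hFc n).isOpen_compl.isGδ.union ((finite_Iio n).image d).isGδ
    · rintro ⟨hxV, hxO⟩
      refine ⟨hxV, fun W hW hxW hG => ?_⟩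
      obtain ⟨z, hzW, hzO⟩ := mem_closure_iff.1 hxO W hW hxW
      obtain ⟨_, ⟨n, rfl⟩, hzb, hbW⟩ := hB.exists_subset_of_mem_open hzW hW
      obtain ⟨g, hg1, hg2, hg3, hg4⟩ := hQg n ⟨z, hzb, hzO⟩
      refine cantor_not_gdelta (Q := g ⁻¹' (D A ∩ W)) ?_ ?_ (hG.preimage hg1)
      · exact ((hDc A hA).mono inter_subset_left).preimage hg2
      · refine hg4.mono fun y hy => ⟨Or.inl (Or.inr (mem_iUnion.2 ⟨n, hy⟩)), hbW (hg3 ⟨y, rfl⟩)⟩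
  have hDE : ∀ A, D A ∩ (V ∩ frontier (closure O)) = f '' A := by
    intro A
    ext z
    constructor
    · rintro ⟨(⟨m, rfl⟩ | hz) | hz, hzV, hzf⟩
      · exact absurd hzf (hdF m hzV 0 (by omega))
      · obtain ⟨m, hm⟩ := mem_iUnion.1 hz
        have : z ∈ interior (closure O) := interior_maximal subset_closure hO (hQO m hm)
        exact absurd this hzf.2
      · exact hz
    · rintro ⟨q, hq, rfl⟩
      exact ⟨Or.inr ⟨q, hq, rfl⟩, hfV q, hfcl q⟩
  have hfr : V ∩ frontier (V ∩ closure O) = V ∩ frontier (closure O) := by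
    rw [inter_comm V (frontier _), inter_comm V (frontier _), inter_comm V (closure O)]
    exact frontier_inter_open_inter hV
  refine ⟨f, hfc, hfi, D, fun A hA => ⟨hDc A hA, hDd A⟩, fun A A' hA hA' h hh => ?_⟩
  have h1 : h '' (V ∩ closure O) = V ∩ closure O := by
    have := nSet_image h (D := D A) (hVh h)
    rwa [hh, hN A hA, hN A' hA'] at this
  have h2 : h '' (V ∩ frontier (closure O)) = V ∩ frontier (closure O) := by
    rw [← hfr, image_inter h.injective, h.image_frontier, h1, hVh h]
  rw [← hDE A, ← hDE A', image_inter h.injective, hh, h2]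

/-- The first case. -/
theorem case_one {X : Type*} [TopologicalSpace X] [SecondCountableTopology X]
    (hz : interior (zSet X) = ∅) {f : (ℕ → Bool) → X} (hf : ∀ q, f q ∈ zSet X) :
    ∃ D : Set (ℕ → Bool) → Set X, (∀ A, A.Countable → (D A).Countable ∧ Dense (D A)) ∧
      ∀ A B, A.Countable → B.Countable → ∀ h : X ≃ₜ X, h '' D A = D B →
        h '' (f '' A) = f '' B := by
  obtain ⟨B, hBc, hB0, hB⟩ := TopologicalSpace.exists_countable_basis X
  have hd : Dense (zSet X)ᶜ := interior_eq_empty_iff_dense_compl.1 hz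
  have hpt : ∀ b : B, ∃ x ∈ (b : Set X), x ∉ zSet X := by
    rintro ⟨b, hb⟩
    exact hd.inter_open_nonempty b (hB.isOpen hb) (nonempty_iff_ne_empty.2 fun h => hB0 (h ▸ hb))
  choose d hdb hdz using hpt
  have : Countable B := hBc
  have hDE : ∀ A, (range d ∪ f '' A) ∩ zSet X = f '' A := by
    intro A
    ext z
    constructor
    · rintro ⟨⟨b, rfl⟩ | hz, hzz⟩
      · exact absurd hzz (hdz b)
      · exact hz
    · rintro ⟨q, hq, rfl⟩
      exact ⟨Or.inr ⟨q, hq, rfl⟩, hf q⟩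
  refine ⟨fun A => range d ∪ f '' A, fun A hA => ⟨(countable_range d).union (hA.image f), ?_⟩, ?_⟩
  · rw [hB.dense_iff]
    intro b hb _
    exact ⟨d ⟨b, hb⟩, hdb ⟨b, hb⟩, Or.inl ⟨_, rfl⟩⟩
  · intro A A' _ _ h hh
    rw [← hDE A, ← hDE A', image_inter h.injective, hh, zSet_image]

/-- If a separable metrizable space `X` has an open subset which is meager in `X` and
contains a copy of the Cantor set `2^ω`, then `X` has continuum many types of countable
dense subsets: there is a family of countable dense subsets, indexed by the Cantor set
(a set of cardinality `𝔠`), no two distinct members of which are mapped onto each other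
by a self-homeomorphism of `X`. -/
theorem stmt_4 {X : Type*} [TopologicalSpace X] [TopologicalSpace.MetrizableSpace X]
    [TopologicalSpace.SeparableSpace X]
    (hU : ∃ U : Set X, IsOpen U ∧ MeagerIn U ∧
      ∃ K : Set X, K ⊆ U ∧ Nonempty (↥K ≃ₜ (ℕ → Bool))) :
    ∃ D : (ℕ → Bool) → Set X, (∀ α, (D α).Countable ∧ Dense (D α)) ∧
      ∀ α β : ℕ → Bool, α ≠ β → ∀ h : X ≃ₜ X, h '' (D α) ≠ D β := by
  letI : MetricSpace X := TopologicalSpace.metrizableSpaceMetric X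
  haveI : SecondCountableTopology X := UniformSpace.secondCountable_of_separable X
  have main : ∃ f : (ℕ → Bool) → X, Continuous f ∧ Function.Injective f ∧
    ∃ D : Set (ℕ → Bool) → Set X, (∀ A, A.Countable → (D A).Countable ∧ Dense (D A)) ∧
      ∀ A B, A.Countable → B.Countable → ∀ h : X ≃ₜ X, h '' D A = D B →
        h '' (f '' A) = f '' B := by
    rcases (interior (zSet X)).eq_empty_or_nonempty with hz | hz
    · obtain ⟨U, hUo, ⟨s, hs, hUs⟩, K, hKU, ⟨e⟩⟩ := hU
      have hc : Continuous (fun q => (e.symm q : X)) :=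
        continuous_subtype_val.comp e.symm.continuous
      have hi : Function.Injective (fun q => (e.symm q : X)) :=
        Subtype.val_injective.comp e.symm.injective
      refine ⟨_, hc, hi, case_one hz fun q => ⟨⟨U, hUo, hKU (e.symm q).2, ?_⟩, ?_⟩⟩
      · rw [hUs]
        exact isMeagre_iUnion fun n => (hs n).isMeagre
      · intro O hO hq
        exact hasCantor_nhds hc hi q hO hq
    · exact case_two hz
  obtain ⟨f, hfc, hfi, D, hD, hh⟩ := main
  have hfe : IsClosedEmbedding f := hfc.isClosedEmbedding hfi
  let S : (ℕ → Bool) → Set ℕ := fun α => {n | ∃ m, n = m + 1 ∧ α m = true}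
  refine ⟨fun α => D (codeSet (S α)), fun α => hD _ (codeSet_countable _), ?_⟩
  intro α β hne h heq
  have h1 := hh _ _ (codeSet_countable _) (codeSet_countable _) h heq
  have h2 := congrArg cbRanks h1
  rw [cbRanks_image h.isClosedEmbedding, cbRanks_image hfe, cbRanks_image hfe,
    cbRanks_codeSet, cbRanks_codeSet] at h2
  apply hne
  funext m
  have h3 : m + 1 ∈ {k | k = 0 ∨ k ∈ S α} ↔ m + 1 ∈ {k | k = 0 ∨ k ∈ S β} := by rw [h2]
  simp [S] at h3
  exact h3
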